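/- Let C be a sorting network of depth d on n channels without redundant comparators. Then every comparator (i,j) in layer d−1 of C satisfies j − i ≤ 3. Furthermore, if j = i+2, then the last layer L_d contains the comparator (i,i+1) or the comparator (i+1,i+2); and if j = i+3, then L_d contains both (i,i+1) and (i+2,i+3). -/

import Mathlib

/-- Apply one parallel layer of comparators to a 0/1 vector (Bool: false = 0, true = 1):
each comparator `(i,j)` puts the minimum on channel `i` and the maximum on channel `j`. -/
def applyLayer {n : ℕ} (L : Finset (Fin n × Fin n)) (x : Fin n → Bool) : Fin n → Bool :=
  fun c => (x c && decide (∀ j, (c, j) ∈ L → x j = true)) ||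
           decide (∃ i, (i, c) ∈ L ∧ x i = true)

/-- Apply a comparator network (a list of layers) to a 0/1 vector, layer by layer. -/
def applyNet {n : ℕ} (C : List (Finset (Fin n × Fin n))) (x : Fin n → Bool) : Fin n → Bool :=
  C.foldl (fun v L => applyLayer L v) x

/-- A valid layer: each comparator `(i,j)` has `i < j`, and every channel appears
in at most one comparator of the layer. -/
def ValidLayer {n : ℕ} (L : Finset (Fin n × Fin n)) : Prop :=
  (∀ p ∈ L, p.1 < p.2) ∧
  ∀ p ∈ L, ∀ q ∈ L, p ≠ q → p.1 ≠ q.1 ∧ p.1 ≠ q.2 ∧ p.2 ≠ q.1 ∧ p.2 ≠ q.2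

/-- A valid comparator network: every layer is valid. -/
def ValidNet {n : ℕ} (C : List (Finset (Fin n × Fin n))) : Prop :=
  ∀ L ∈ C, ValidLayer L

/-- A 0/1 vector is sorted in ascending order. -/
def SortedVec {n : ℕ} (x : Fin n → Bool) : Prop :=
  ∀ i j : Fin n, i ≤ j → x i ≤ x j

/-- A sorting network: a valid network sorting every 0/1 input. -/
def SortingNet {n : ℕ} (C : List (Finset (Fin n × Fin n))) : Prop :=
  ValidNet C ∧ ∀ x : Fin n → Bool, SortedVec (applyNet C x)

/-- The comparator `p` placed in the layer of index `k` (0-based) is redundant: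
its top input is already ≤ its bottom input on every output of the prefix
(comparators in the same layer act on disjoint channels, so they do not affect
the inputs of `p`). -/
def Redundant {n : ℕ} (C : List (Finset (Fin n × Fin n))) (k : ℕ) (p : Fin n × Fin n) : Prop :=
  ∀ x : Fin n → Bool, applyNet (C.take k) x p.1 ≤ applyNet (C.take k) x p.2

/-- No comparator of the network is redundant. -/
def NonRedundant {n : ℕ} (C : List (Finset (Fin n × Fin n))) : Prop :=
  ∀ k : ℕ, ∀ p ∈ C.getD k ∅, ¬ Redundant C k p

def VDiff {n : ℕ} (u v : Fin n → Bool) (c : Fin n) : Prop :=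
  u c = false ∧ v c = true ∧ ∀ e, e ≠ c → u e = v e

lemma VDiff.unique {n : ℕ} {u v : Fin n → Bool} {c e : Fin n} (h : VDiff u v c)
    (hu : u e = false) (hv : v e = true) : e = c := by
  by_contra hne
  have := h.2.2 e hne
  simp_all

lemma layer_max {n : ℕ} {L : Finset (Fin n × Fin n)} (hL : ValidLayer L) {a b : Fin n}
    (h : (a, b) ∈ L) (x : Fin n → Bool) : applyLayer L x b = (x a || x b) := by
  have h1 : ∀ i, (i, b) ∈ L → i = a := by
    intro i hi
    by_contra hne
    exact (hL.2 _ hi _ h (by simp [hne])).2.2.2 rfl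
  have h2 : ∀ j, (b, j) ∉ L := by
    intro j hj
    have hab := hL.1 _ h
    have : (b, j) ≠ (a, b) := by
      intro he
      simp only [Prod.mk.injEq] at he
      simp [he.1] at hab
    exact (hL.2 _ hj _ h this).2.1 rfl
  have h3 : (∃ i, (i, b) ∈ L ∧ x i = true) ↔ x a = true :=
    ⟨fun ⟨i, hi, hx⟩ => h1 i hi ▸ hx, fun hx => ⟨a, h, hx⟩⟩
  simp [applyLayer, h2, h3, Bool.or_comm]

lemma layer_min {n : ℕ} {L : Finset (Fin n × Fin n)} (hL : ValidLayer L) {a b : Fin n}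
    (h : (a, b) ∈ L) (x : Fin n → Bool) : applyLayer L x a = (x a && x b) := by
  have h1 : ∀ j, (a, j) ∈ L → j = b := by
    intro i hi
    by_contra hne
    exact (hL.2 _ hi _ h (by simp [hne])).1 rfl
  have h2 : ∀ j, (j, a) ∉ L := by
    intro j hj
    have hab := hL.1 _ h
    have : (j, a) ≠ (a, b) := by
      intro he
      simp only [Prod.mk.injEq] at he
      simp [he.2] at hab
    exact (hL.2 _ hj _ h this).2.2.1 rfl
  have h3 : (∀ j, (a, j) ∈ L → x j = true) ↔ x b = true :=
    ⟨fun hx => hx b h, fun hx j hj => h1 j hj ▸ hx⟩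
  simp [applyLayer, h2, h3]

lemma layer_id {n : ℕ} {L : Finset (Fin n × Fin n)} {c : Fin n}
    (h1 : ∀ j, (c, j) ∉ L) (h2 : ∀ j, (j, c) ∉ L) (x : Fin n → Bool) :
    applyLayer L x c = x c := by
  simp [applyLayer, h1, h2]

lemma layer_cases {n : ℕ} (L : Finset (Fin n × Fin n)) (c : Fin n) :
    (∃ j, (c, j) ∈ L) ∨ (∃ j, (j, c) ∈ L) ∨ ((∀ j, (c, j) ∉ L) ∧ ∀ j, (j, c) ∉ L) := by
  by_cases h : ∃ j, (c, j) ∈ L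
  · exact Or.inl h
  by_cases h' : ∃ j, (j, c) ∈ L
  · exact Or.inr (Or.inl h')
  · push Not at h h'
    exact Or.inr (Or.inr ⟨h, h'⟩)

lemma layer_congr {n : ℕ} {L : Finset (Fin n × Fin n)} (hL : ValidLayer L) {u v : Fin n → Bool}
    {e : Fin n} (h : u e = v e) (h1 : ∀ j, (e, j) ∈ L → u j = v j)
    (h2 : ∀ j, (j, e) ∈ L → u j = v j) : applyLayer L u e = applyLayer L v e := by
  rcases layer_cases L e with ⟨j, hj⟩ | ⟨j, hj⟩ | ⟨ha, hb⟩
  · rw [layer_min hL hj, layer_min hL hj, h, h1 j hj]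
  · rw [layer_max hL hj, layer_max hL hj, h, h2 j hj]
  · rw [layer_id ha hb, layer_id ha hb, h]

lemma layer_diff_pair {n : ℕ} {L : Finset (Fin n × Fin n)} (hL : ValidLayer L)
    {u v : Fin n → Bool} {a b c : Fin n} (hab : (a, b) ∈ L) (hc : c = a ∨ c = b)
    (h : VDiff u v c) :
    VDiff (applyLayer L u) (applyLayer L v) a ∨ VDiff (applyLayer L u) (applyLayer L v) b := by
  have hne : a ≠ b := ne_of_lt (hL.1 _ hab)
  have hoth : ∀ e, e ≠ a → e ≠ b → applyLayer L u e = applyLayer L v e := by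
    intro e hea heb
    have hz : ∀ z, z ≠ a → z ≠ b → u z = v z := by
      intro z h1 h2
      apply h.2.2
      rcases hc with rfl | rfl <;> assumption
    refine layer_congr hL (hz e hea heb) ?_ ?_
    · intro j hj
      have := hL.2 _ hj _ hab (by simp [hea])
      exact hz j this.2.2.1 this.2.2.2
    · intro j hj
      have := hL.2 _ hj _ hab (by simp [heb])
      exact hz j this.1 this.2.1
  have e1 := layer_min hL hab u
  have e2 := layer_min hL hab v
  have e3 := layer_max hL hab u
  have e4 := layer_max hL hab v
  obtain ⟨h1, h2, h3⟩ := h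
  have key : (applyLayer L u a = false ∧ applyLayer L v a = true ∧
        applyLayer L u b = applyLayer L v b) ∨
      (applyLayer L u b = false ∧ applyLayer L v b = true ∧
        applyLayer L u a = applyLayer L v a) := by
    rw [e1, e2, e3, e4]
    rcases hc with rfl | rfl
    · rw [h1, h2, h3 b hne.symm]
      cases v b <;> simp
    · rw [h1, h2, h3 a hne]
      cases v a <;> simp
  rcases key with ⟨k1, k2, k3⟩ | ⟨k1, k2, k3⟩
  · left
    refine ⟨k1, k2, fun e he => ?_⟩
    by_cases hb : e = b
    · rw [hb, k3]
    · exact hoth e he hb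
  · right
    refine ⟨k1, k2, fun e he => ?_⟩
    by_cases ha : e = a
    · rw [ha, k3]
    · exact hoth e ha he

lemma layer_diff {n : ℕ} {L : Finset (Fin n × Fin n)} (hL : ValidLayer L)
    {u v : Fin n → Bool} {c : Fin n} (h : VDiff u v c) :
    ∃ c', VDiff (applyLayer L u) (applyLayer L v) c' ∧ (c' = c ∨ (c, c') ∈ L ∨ (c', c) ∈ L) := by
  rcases layer_cases L c with ⟨j, hj⟩ | ⟨j, hj⟩ | ⟨ha, hb⟩
  · rcases layer_diff_pair hL hj (Or.inl rfl) h with h' | h'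
    · exact ⟨_, h', Or.inl rfl⟩
    · exact ⟨_, h', Or.inr (Or.inl hj)⟩
  · rcases layer_diff_pair hL hj (Or.inr rfl) h with h' | h'
    · exact ⟨_, h', Or.inr (Or.inr hj)⟩
    · exact ⟨_, h', Or.inl rfl⟩
  · refine ⟨c, ⟨?_, ?_, fun e he => ?_⟩, Or.inl rfl⟩
    · rw [layer_id ha hb, h.1]
    · rw [layer_id ha hb, h.2.1]
    · refine layer_congr hL (h.2.2 e he) ?_ ?_
      · intro j hj
        exact h.2.2 j (fun hjc => hb e (hjc ▸ hj))
      · intro j hj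
        exact h.2.2 j (fun hjc => ha e (hjc ▸ hj))

lemma net_diff {n : ℕ} (C : List (Finset (Fin n × Fin n))) (hC : ValidNet C) :
    ∀ {u v : Fin n → Bool} {c : Fin n}, VDiff u v c →
    ∃ c', VDiff (applyNet C u) (applyNet C v) c' := by
  induction C with
  | nil => intro u v c h; exact ⟨c, h⟩
  | cons L C ih =>
    intro u v c h
    obtain ⟨c', h', -⟩ := layer_diff (hC L (by simp)) h
    exact ih (fun M hM => hC M (by simp [hM])) h'

lemma layer_sorted {n : ℕ} {L : Finset (Fin n × Fin n)} (hL : ValidLayer L)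
    {x : Fin n → Bool} (hx : SortedVec x) : applyLayer L x = x := by
  funext c
  rcases layer_cases L c with ⟨j, hj⟩ | ⟨j, hj⟩ | ⟨ha, hb⟩
  · rw [layer_min hL hj]
    have := hx c j (le_of_lt (hL.1 _ hj))
    revert this
    cases x c <;> cases x j <;> simp
  · rw [layer_max hL hj]
    have := hx j c (le_of_lt (hL.1 _ hj))
    revert this
    cases x c <;> cases x j <;> simp
  · rw [layer_id ha hb]

lemma net_sorted {n : ℕ} (C : List (Finset (Fin n × Fin n))) (hC : ValidNet C)
    {x : Fin n → Bool} (hx : SortedVec x) : applyNet C x = x := by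
  induction C with
  | nil => rfl
  | cons L C ih =>
    have h1 := layer_sorted (hC L (by simp)) hx
    have h2 := ih (fun M hM => hC M (by simp [hM]))
    simp only [applyNet, List.foldl_cons] at *
    rw [h1, h2]

def gnet {n : ℕ} (C : List (Finset (Fin n × Fin n))) (S : Finset (Fin n)) : Fin n → Bool :=
  applyNet C (fun c => decide (c ∈ S))

lemma gnet_diff {n : ℕ} (C : List (Finset (Fin n × Fin n))) (hC : ValidNet C)
    {S : Finset (Fin n)} {b : Fin n} (hb : b ∉ S) :
    ∃ c, VDiff (gnet C S) (gnet C (insert b S)) c := by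
  apply net_diff C hC (c := b)
  refine ⟨by simp [hb], by simp, fun e he => by simp [he]⟩

lemma gnet_card {n : ℕ} (C : List (Finset (Fin n × Fin n))) (hC : ValidNet C)
    (S : Finset (Fin n)) : (Finset.univ.filter (fun c => gnet C S c = true)).card = S.card := by
  induction S using Finset.induction_on with
  | empty =>
    have : gnet C ∅ = fun _ => false := by
      unfold gnet
      rw [net_sorted C hC]
      · simp
      · intro i j _; simp
    simp [this]
  | insert b S hb ih =>
    obtain ⟨c, h1, h2, h3⟩ := gnet_diff C hC hb
    rw [Finset.card_insert_of_notMem hb, ← ih]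
    have : (Finset.univ.filter (fun c => gnet C (insert b S) c = true)) =
        insert c (Finset.univ.filter (fun c => gnet C S c = true)) := by
      ext e
      by_cases he : e = c
      · subst he; simp [h2]
      · simp [he, h3 e he]
    rw [this, Finset.card_insert_of_notMem]
    simp [h1]

lemma gnet_pos {n : ℕ} {C : List (Finset (Fin n × Fin n))} (hC : SortingNet C)
    {S : Finset (Fin n)} {b : Fin n} {c : Fin n}
    (h : VDiff (gnet C S) (gnet C (insert b S)) c) : (c : ℕ) + S.card + 1 = n := by
  have e := gnet_card C hC.1 S
  have hs1 := hC.2 (fun c => decide (c ∈ S))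
  have hs2 := hC.2 (fun c => decide (c ∈ insert b S))
  change SortedVec (gnet C S) at hs1
  change SortedVec (gnet C (insert b S)) at hs2
  have : (Finset.univ.filter (fun c => gnet C S c = true)) = Finset.Ioi c := by
    ext e
    simp only [Finset.mem_filter, Finset.mem_univ, true_and, Finset.mem_Ioi]
    constructor
    · intro he
      by_contra hlt
      have := hs1 e c (not_lt.mp hlt)
      rw [he, h.1] at this
      exact absurd this (by decide)
    · intro he
      rw [h.2.2 e (ne_of_gt he)]
      have := hs2 c e he.le
      rw [h.2.1] at this
      exact top_le_iff.mp this
  rw [this, Fin.card_Ioi] at e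
  have := c.2
  omega

lemma gnet_mono {n : ℕ} (C : List (Finset (Fin n × Fin n))) (hC : ValidNet C)
    {S T : Finset (Fin n)} (hST : S ⊆ T) (i : Fin n) (h : gnet C S i = true) :
    gnet C T i = true := by
  induction T using Finset.strongInduction with
  | H T ih =>
    by_cases he : S = T
    · rwa [← he]
    obtain ⟨b, hbT, hbS⟩ := Finset.exists_of_ssubset (lt_of_le_of_ne hST he)
    have h1 := ih (T.erase b) (Finset.erase_ssubset hbT)
      (fun x hx => Finset.mem_erase.mpr ⟨fun hxb => hbS (hxb ▸ hx), hST hx⟩)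
    obtain ⟨c, k1, k2, k3⟩ := gnet_diff C hC (Finset.notMem_erase b T)
    rw [Finset.insert_erase hbT] at k2 k3
    by_cases hic : i = c
    · rw [hic, k2]
    · rw [← k3 i hic, h1]

lemma gnet_step {n : ℕ} (C : List (Finset (Fin n × Fin n))) (hC : ValidNet C) (i : Fin n)
    (T : Finset (Fin n)) (hT : gnet C T i = true) :
    ∀ (m : ℕ) (S : Finset (Fin n)), (T \ S).card = m → T.card ≤ S.card → gnet C S i = false →
    ∃ (U : Finset (Fin n)) (b : Fin n), b ∉ U ∧ U.card = S.card ∧ gnet C U i = false ∧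
      gnet C (insert b U) i = true := by
  intro m
  induction m with
  | zero =>
    intro S h0 _ hf
    have : T ⊆ S := by simpa [Finset.sdiff_eq_empty_iff_subset] using h0
    have := gnet_mono C hC this i hT
    simp [hf] at this
  | succ m ih =>
    intro S hm hle hf
    obtain ⟨b, hb⟩ : (T \ S).Nonempty := Finset.card_pos.mp (by omega)
    rw [Finset.mem_sdiff] at hb
    by_cases hi : gnet C (insert b S) i = true
    · exact ⟨S, b, hb.2, rfl, hf, hi⟩
    have hST : ¬ S ⊆ T := by
      intro h
      have := Finset.eq_of_subset_of_card_le h hle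
      exact hb.2 (this ▸ hb.1)
    obtain ⟨a, haS, haT⟩ := Finset.not_subset.mp hST
    have hab : a ∈ insert b S := by simp [haS]
    have hc : ((insert b S).erase a).card = S.card := by
      rw [Finset.card_erase_of_mem hab, Finset.card_insert_of_notMem hb.2]; rfl
    have hd : T \ ((insert b S).erase a) = (T \ S).erase b := by
      ext e
      simp only [Finset.mem_sdiff, Finset.mem_erase, Finset.mem_insert]
      by_cases hea : e = a
      · subst hea; simp [haT]
      · simp only [hea, not_false_eq_true, ne_eq, true_and]
        tauto
    have hcd : (T \ ((insert b S).erase a)).card = m := by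
      rw [hd, Finset.card_erase_of_mem (by simp [hb]), hm]; rfl
    have hff : gnet C ((insert b S).erase a) i = false := by
      by_contra hne
      exact hi (gnet_mono C hC (Finset.erase_subset a _) i (by simpa using hne))
    obtain ⟨U, b', h1, h2, h3⟩ := ih _ hcd (by omega) hff
    exact ⟨U, b', h1, by omega, h3⟩

lemma gnet_first {n : ℕ} (C : List (Finset (Fin n × Fin n))) (hC : ValidNet C) (i j : Fin n)
    (T : Finset (Fin n)) (hT : gnet C T i = true) (hj : gnet C T j = false) :
    ∃ (U : Finset (Fin n)) (b : Fin n), b ∉ U ∧ gnet C U i = false ∧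
      gnet C (insert b U) i = true ∧ gnet C (insert b U) j = false := by
  induction T using Finset.strongInduction with
  | H T ih =>
    by_cases he : T = ∅
    · subst he
      have : gnet C ∅ = fun _ => false := by
        unfold gnet
        rw [net_sorted C hC]
        · simp
        · intro i j _; simp
      simp [this] at hT
    obtain ⟨b, hb⟩ := Finset.nonempty_iff_ne_empty.mpr he
    by_cases h : gnet C (T.erase b) i = true
    · refine ih _ (Finset.erase_ssubset hb) h ?_
      by_contra hne
      have := gnet_mono C hC (Finset.erase_subset b T) j (by simpa using hne)
      simp [hj] at this
    · exact ⟨T.erase b, b, by simp, by simpa using h, by rwa [Finset.insert_erase hb],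
        by rwa [Finset.insert_erase hb]⟩

/-- Flip pairs: on some input pair, the prefix state differs exactly at `i` and the final
output differs exactly at `k`. -/
lemma key_interval {n : ℕ} (P Q : List (Finset (Fin n × Fin n))) (hC : SortingNet (P ++ Q))
    (i j : Fin n) (x : Fin n → Bool) (hi : applyNet P x i = true) (hj : applyNet P x j = false) :
    ∃ A : Fin n, (∃ u v : Fin n → Bool, VDiff u v i ∧ v j = false ∧
        VDiff (applyNet Q u) (applyNet Q v) A) ∧
      ∀ k : Fin n, i < k → k ≤ A → ∃ u v : Fin n → Bool, VDiff u v i ∧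
        VDiff (applyNet Q u) (applyNet Q v) k := by
  have hP : ValidNet P := fun L hL => hC.1 L (by simp [hL])
  have happ : ∀ S, gnet (P ++ Q) S = applyNet Q (gnet P S) := by
    intro S; simp [gnet, applyNet]
  obtain ⟨T, hTx⟩ : ∃ T : Finset (Fin n), (fun c => decide (c ∈ T)) = x :=
    ⟨Finset.univ.filter (fun c => x c = true), by funext c; simp⟩
  rw [← hTx] at hi hj
  change gnet P T i = true at hi
  change gnet P T j = false at hj
  obtain ⟨U, b, hbU, h1, h2, h3⟩ := gnet_first P hP i j T hi hj
  obtain ⟨c, hc⟩ := gnet_diff P hP hbU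
  obtain rfl := hc.unique h1 h2
  obtain ⟨A, hA⟩ := gnet_diff (P ++ Q) hC.1 hbU
  have hApos := gnet_pos hC hA
  refine ⟨A, ⟨gnet P U, gnet P (insert b U), hc, h3, by rwa [← happ, ← happ]⟩, ?_⟩
  intro k hik hkA
  rcases eq_or_lt_of_le hkA with rfl | hlt
  · exact ⟨gnet P U, gnet P (insert b U), hc, by rwa [← happ, ← happ]⟩
  have hS : gnet P (Finset.Ioi k) i = false := by
    unfold gnet
    rw [net_sorted P hP]
    · simp [hik.le]
    · intro a b hab
      by_cases h : k < a
      · simp [h, lt_of_lt_of_le h hab]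
      · simp [h]
  have hlt' : (k : ℕ) < A := hlt
  have hcard : (insert b U).card ≤ (Finset.Ioi k).card := by
    rw [Fin.card_Ioi, Finset.card_insert_of_notMem hbU]
    omega
  obtain ⟨V, b', hb', hVc, hV1, hV2⟩ := gnet_step P hP i _ h2 _ (Finset.Ioi k) rfl hcard hS
  obtain ⟨c', hc'⟩ := gnet_diff P hP hb'
  obtain rfl := hc'.unique hV1 hV2
  obtain ⟨B, hB⟩ := gnet_diff (P ++ Q) hC.1 hb'
  have hBpos := gnet_pos hC hB
  have hBk : B = k := by
    rw [Fin.card_Ioi] at hVc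
    have := k.2
    apply Fin.ext
    omega
  subst hBk
  exact ⟨gnet P V, gnet P (insert b' V), hc', by rwa [← happ, ← happ]⟩

lemma layer_part {n : ℕ} {L : Finset (Fin n × Fin n)} (hL : ValidLayer L) {i j k : Fin n}
    (hij : (i, j) ∈ L) {u v : Fin n → Bool} (h : VDiff u v i)
    (h' : VDiff (applyLayer L u) (applyLayer L v) k) : k = i ∨ k = j := by
  rcases layer_diff_pair hL hij (Or.inl rfl) h with g | g
  · exact Or.inl (g.unique h'.1 h'.2.1)
  · exact Or.inr (g.unique h'.1 h'.2.1)

lemma layer_swap {n : ℕ} {L : Finset (Fin n × Fin n)} (hL : ValidLayer L) {i j : Fin n}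
    (hij : (i, j) ∈ L) {u v : Fin n → Bool} (h : VDiff u v i) (hv : v j = false) :
    VDiff (applyLayer L u) (applyLayer L v) j := by
  rcases layer_diff_pair hL hij (Or.inl rfl) h with g | g
  · have := g.2.1
    rw [layer_min hL hij, hv] at this
    simp at this
  · exact g

lemma not_redundant {n : ℕ} {P : List (Finset (Fin n × Fin n))} {p : Fin n × Fin n}
    (h : ¬ ∀ x : Fin n → Bool, applyNet P x p.1 ≤ applyNet P x p.2) :
    ∃ x, applyNet P x p.1 = true ∧ applyNet P x p.2 = false := by
  push Not at h
  obtain ⟨x, hx⟩ := h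
  refine ⟨x, ?_⟩
  revert hx
  cases applyNet P x p.1 <;> cases applyNet P x p.2 <;> simp

lemma last_layer {n : ℕ} (P : List (Finset (Fin n × Fin n))) (L : Finset (Fin n × Fin n))
    (hC : SortingNet (P ++ [L])) (i j : Fin n) (hij : (i, j) ∈ L) (x : Fin n → Bool)
    (hi : applyNet P x i = true) (hj : applyNet P x j = false) : (j : ℕ) = i + 1 := by
  have hL : ValidLayer L := hC.1 L (by simp)
  have hlt : (i : ℕ) < j := hL.1 _ hij
  obtain ⟨A, ⟨u, v, h1, h2, h3⟩, hk⟩ := key_interval P [L] hC i j x hi hj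
  obtain rfl : A = j := h3.unique (layer_swap hL hij h1 h2).1 (layer_swap hL hij h1 h2).2.1 |>.symm
  by_contra hne
  have hA := A.2
  obtain ⟨u', v', g1, g2⟩ := hk ⟨i + 1, by omega⟩ (by simp [Fin.lt_def]) (by
    rw [Fin.le_def]; simp; omega)
  rcases layer_part hL hij g1 g2 with h | h
  · have := congrArg Fin.val h
    simp at this
  · have := congrArg Fin.val h
    simp at this
    omega

/-- in a non-redundant sorting network of depth `d`, every comparator `(i,j)`
of the penultimate layer satisfies `j - i ≤ 3`; if `j = i + 2` then the last layer contains
`(i,i+1)` or `(i+1,i+2)`; and if `j = i + 3` then it contains both `(i,i+1)` and `(i+2,i+3)`. -/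
theorem penultimate_layer_span {n d : ℕ}
    (C : List (Finset (Fin n × Fin n))) (hd : C.length = d) (hd2 : 2 ≤ d)
    (hC : SortingNet C) (hNR : NonRedundant C)
    (p : Fin n × Fin n) (hp : p ∈ C.getD (d - 2) ∅) :
    (p.2 : ℕ) ≤ (p.1 : ℕ) + 3 ∧
    ((p.2 : ℕ) = (p.1 : ℕ) + 2 →
      ∃ q ∈ C.getD (d - 1) ∅,
        ((q.1 : ℕ) = (p.1 : ℕ) ∧ (q.2 : ℕ) = (p.1 : ℕ) + 1) ∨
        ((q.1 : ℕ) = (p.1 : ℕ) + 1 ∧ (q.2 : ℕ) = (p.1 : ℕ) + 2)) ∧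
    ((p.2 : ℕ) = (p.1 : ℕ) + 3 →
      (∃ q ∈ C.getD (d - 1) ∅, (q.1 : ℕ) = (p.1 : ℕ) ∧ (q.2 : ℕ) = (p.1 : ℕ) + 1) ∧
      (∃ q ∈ C.getD (d - 1) ∅, (q.1 : ℕ) = (p.1 : ℕ) + 2 ∧ (q.2 : ℕ) = (p.1 : ℕ) + 3)) := by
  obtain ⟨P, L1, L2, rfl⟩ : ∃ P L1 L2, C = P ++ [L1, L2] := by
    refine ⟨C.take (d - 2), C[d - 2], C[d - 1], ?_⟩
    conv_lhs => rw [← List.take_append_drop (d - 2) C]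
    congr 1
    rw [List.drop_eq_getElem_cons (by omega), List.drop_eq_getElem_cons (by omega),
      List.drop_eq_nil_of_le (by omega)]
    congr 3
    omega
  have hdl : d = P.length + 2 := by simpa using hd.symm
  subst hdl
  have e1 : (P ++ [L1, L2]).getD (P.length + 2 - 2) ∅ = L1 := by simp
  have e2 : (P ++ [L1, L2]).getD (P.length + 2 - 1) ∅ = L2 := by simp
  rw [e1] at hp
  rw [e2]
  have hL1 : ValidLayer L1 := hC.1 L1 (by simp)
  have hL2 : ValidLayer L2 := hC.1 L2 (by simp)
  have hlast : ∀ a b : Fin n, (a, b) ∈ L2 → (b : ℕ) = a + 1 := by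
    intro a b hab
    have h := hNR (P.length + 1) (a, b) (by simpa using hab)
    unfold Redundant at h
    have e3 : (P ++ [L1, L2]).take (P.length + 1) = P ++ [L1] := by
      simp [List.take_append]
    rw [e3] at h
    obtain ⟨x, hx1, hx2⟩ := not_redundant h
    exact last_layer (P ++ [L1]) L2 (by simpa using hC) a b hab x hx1 hx2
  obtain ⟨x, hx1, hx2⟩ : ∃ x, applyNet P x p.1 = true ∧ applyNet P x p.2 = false := by
    have h := hNR P.length p (by simpa using hp)
    unfold Redundant at h
    have e3 : (P ++ [L1, L2]).take P.length = P := by simp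
    rw [e3] at h
    exact not_redundant h
  obtain ⟨i, j⟩ := p
  simp only at hx1 hx2 ⊢
  have hij : (i : ℕ) < j := hL1.1 _ hp
  obtain ⟨A, ⟨u, v, h1, h2, h3⟩, hk⟩ := key_interval P [L1, L2] hC i j x hx1 hx2
  have hAj : (j : ℕ) ≤ A + 1 := by
    obtain ⟨c, hc, hcc⟩ := layer_diff hL2 (layer_swap hL1 hp h1 h2)
    obtain rfl : A = c := hc.unique h3.1 h3.2.1
    rcases hcc with h | h | h
    · rw [h]; omega
    · have := hlast _ _ h; omega
    · have := hlast _ _ h; omega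
  have hmain : ∀ k : Fin n, i < k → k < j → (i, k) ∈ L2 ∨ (k, j) ∈ L2 := by
    intro k hik hkj
    have hik' : (i : ℕ) < k := hik
    have hkj' : (k : ℕ) < j := hkj
    obtain ⟨u, v, g1, g2⟩ := hk k hik (by rw [Fin.le_def]; omega)
    obtain ⟨c, hc, -⟩ := layer_diff hL1 g1
    have hcij := layer_part hL1 hp g1 hc
    obtain ⟨c', hc', hcc⟩ := layer_diff hL2 hc
    obtain rfl : k = c' := hc'.unique g2.1 g2.2.1
    rcases hcij with rfl | rfl
    · rcases hcc with h | h | h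
      · exact absurd h (ne_of_gt hik)
      · exact Or.inl h
      · have := hlast _ _ h; omega
    · rcases hcc with h | h | h
      · exact absurd h (ne_of_lt hkj)
      · have := hlast _ _ h; omega
      · exact Or.inr h
  have hjn := j.2
  refine ⟨?_, ?_, ?_⟩
  · by_contra hcon
    rcases hmain ⟨i + 2, by omega⟩ (by rw [Fin.lt_def]; simp) (by rw [Fin.lt_def]; simp; omega)
      with h | h
    · have := hlast _ _ h
      simp at this
    · have := hlast _ _ h
      simp at this
      omega
  · intro hj2
    rcases hmain ⟨i + 1, by omega⟩ (by rw [Fin.lt_def]; simp) (by rw [Fin.lt_def]; simp; omega)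
      with h | h
    · exact ⟨_, h, Or.inl ⟨rfl, rfl⟩⟩
    · exact ⟨_, h, Or.inr ⟨rfl, hj2⟩⟩
  · intro hj3
    constructor
    · rcases hmain ⟨i + 1, by omega⟩ (by rw [Fin.lt_def]; simp)
        (by rw [Fin.lt_def]; simp; omega) with h | h
      · exact ⟨_, h, rfl, rfl⟩
      · have := hlast _ _ h
        simp at this
        omega
    · rcases hmain ⟨i + 2, by omega⟩ (by rw [Fin.lt_def]; simp)
        (by rw [Fin.lt_def]; simp; omega) with h | h
      · have := hlast _ _ h
        simp at this
      · exact ⟨_, h, rfl, hj3⟩
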